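/- Let S be a left Rees monoid. Then there exists a group H and an injective monoid homomorphism from S into H if and only if S is right cancellative. -/

import Mathlib

/-- A length function on a monoid: a homomorphism to (ℕ, +) whose zero set is
exactly the set of units. -/
def IsLengthFunction {S : Type*} [Monoid S] (l : S → ℕ) : Prop :=
  (∀ a b : S, l (a * b) = l a + l b) ∧ ∀ a : S, l a = 0 ↔ IsUnit a

/-- An equidivisible monoid. -/
def Equidivisible (S : Type*) [Monoid S] : Prop :=
  ∀ a b c d : S, a * b = c * d →
    (∃ u : S, a = c * u ∧ d = u * b) ∨ ∃ v : S, c = a * v ∧ b = v * d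

/-- A Levi monoid: an equidivisible monoid equipped with a length function and
containing at least one non-unit. -/
def IsLeviMonoid (S : Type*) [Monoid S] : Prop :=
  Equidivisible S ∧ (∃ l : S → ℕ, IsLengthFunction l) ∧ ∃ a : S, ¬IsUnit a

/-- A left Rees monoid: a left cancellative Levi monoid. -/
def IsLeftReesMonoid (S : Type*) [Monoid S] : Prop :=
  (∀ a b c : S, a * b = a * c → b = c) ∧ IsLeviMonoid S

open Cardinal in
/-- Two free actions of a group whose orbit sets both have cardinality `#κ` are isomorphic. -/
lemma exists_equivariant_equiv {P Y Z κ : Type u} [Group P] [MulAction P Y] [MulAction P Z]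
    (hY : ∀ (p : P) (y : Y), p • y = y → p = 1) (hZ : ∀ (p : P) (z : Z), p • z = z → p = 1)
    (hYκ : #Y ≤ #κ) (hZκ : #Z ≤ #κ) (i : κ → Y) (j : κ → Z)
    (hi : ∀ (p : P) (a b : κ), p • i a = i b → a = b)
    (hj : ∀ (p : P) (a b : κ), p • j a = j b → a = b) :
    ∃ e : Y ≃ Z, ∀ (p : P) (y : Y), e (p • y) = p • e y := by
  have orbits_card : ∀ (X : Type u) [MulAction P X], #X ≤ #κ → ∀ i : κ → X,
      (∀ (p : P) (a b : κ), p • i a = i b → a = b) →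
        #(MulAction.orbitRel.Quotient P X) = #κ := by
    intro X _ hX i hi
    refine le_antisymm (mk_quotient_le.trans hX)
      (mk_le_of_injective (f := fun a => (Quotient.mk _ (i a) :
        MulAction.orbitRel.Quotient P X)) fun a b hab => ?_)
    obtain ⟨p, hp⟩ := Quotient.exact hab
    exact (hi p b a hp).symm
  have coordinates : ∀ (X : Type u) [MulAction P X], (∀ (p : P) (x : X), p • x = x → p = 1) →
      ∃ e : MulAction.orbitRel.Quotient P X × P ≃ X,
        ∀ (p : P) q r, e (q, p * r) = p • e (q, r) := by
    intro X _ hX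
    refine ⟨Equiv.ofBijective (fun q => q.2 • q.1.out) ⟨?_, fun x => ?_⟩,
      fun p q r => mul_smul p r _⟩
    · rintro ⟨q, r⟩ ⟨q', r'⟩ h
      have h : r • q.out = r' • q'.out := h
      have hq : q = q' := by
        rw [← q.out_eq, ← q'.out_eq]
        refine Quotient.sound ⟨r⁻¹ * r', ?_⟩
        change (r⁻¹ * r') • q'.out = q.out
        rw [mul_smul, ← h, inv_smul_smul]
      subst hq
      have : (r'⁻¹ * r) • q.out = q.out := by rw [mul_smul, h, inv_smul_smul]
      rw [inv_mul_eq_one.mp (hX _ _ this)]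
    · obtain ⟨p, hp⟩ := Quotient.exact
        (Quotient.out_eq (Quotient.mk _ x : MulAction.orbitRel.Quotient P X))
      have hp : p • x = _ := hp
      refine ⟨(Quotient.mk _ x, p⁻¹), ?_⟩
      change p⁻¹ • Quotient.out _ = x
      rw [← hp, inv_smul_smul]
  obtain ⟨c⟩ := Cardinal.eq.mp ((orbits_card Y hYκ i hi).trans (orbits_card Z hZκ j hj).symm)
  obtain ⟨eY, hEY⟩ := coordinates Y hY
  obtain ⟨eZ, hEZ⟩ := coordinates Z hZ
  refine ⟨eY.symm.trans ((c.prodCongr (Equiv.refl P)).trans eZ), fun p y => ?_⟩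
  obtain ⟨⟨q, r⟩, rfl⟩ := eY.surjective y
  rw [← hEY]
  simp [hEZ]

section Units

variable {S : Type u} [Monoid S]

/-- The pairs of units `(k, l)` with `k * x = x * l`. -/
def unitIntertwiners (x : S) : Subgroup (Sˣ × Sˣ) where
  carrier := {p | (p.1 : S) * x = x * p.2}
  one_mem' := by simp
  mul_mem' := by
    rintro ⟨a, b⟩ ⟨c, d⟩ h h'
    simp only [Set.mem_ofPred_eq, Prod.mk_mul_mk, Units.val_mul] at *
    rw [mul_assoc, h', ← mul_assoc, h, mul_assoc]
  inv_mem' := by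
    rintro ⟨a, b⟩ h
    simp only [Set.mem_ofPred_eq, Prod.inv_mk] at *
    rw [Units.inv_mul_eq_iff_eq_mul, ← mul_assoc, h, mul_assoc, Units.mul_inv, mul_one]

variable (S) in
/-- Units act by left multiplication on `S ⊕ S × κ`. -/
def unitsPermSum (κ : Type u) : Sˣ →* Equiv.Perm (S ⊕ S × κ) where
  toFun u := Equiv.sumCongr u.mulLeft (u.mulLeft.prodCongr (Equiv.refl κ))
  map_one' := by ext (s | ⟨s, a⟩) <;> simp
  map_mul' u v := by ext (s | ⟨s, a⟩) <;> simp [mul_assoc]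

@[simp] lemma unitsPermSum_inl (κ : Type u) (u : Sˣ) (s : S) :
    unitsPermSum S κ u (Sum.inl s) = Sum.inl (u * s) := rfl

@[simp] lemma unitsPermSum_inr (κ : Type u) (u : Sˣ) (s : S × κ) :
    unitsPermSum S κ u (Sum.inr s) = Sum.inr (u * s.1, s.2) := rfl

open Cardinal in
/-- Left multiplication by `x` on `S` extends to a permutation of `S ⊕ S × κ` that is compatible
with the units intertwined by `x`. -/
lemma exists_perm_extending_mulLeft {κ : Type u} [Infinite κ] (hκ : #S ≤ #κ)
    (hl : ∀ a b c : S, a * b = a * c → b = c) (hr : ∀ a b c : S, a * c = b * c → a = b) (x : S) :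
    ∃ t : Equiv.Perm (S ⊕ S × κ), (∀ s, t (Sum.inl s) = Sum.inl (x * s)) ∧
      ∀ k l : Sˣ, (k : S) * x = x * l → unitsPermSum S κ k * t = t * unitsPermSum S κ l := by
  classical
  let R : Set S := Set.range (x * ·)
  have hκ0 : ℵ₀ ≤ #κ := aleph0_le_mk κ
  have hYκ : #(S × κ) ≤ #κ := by
    rw [mk_prod, lift_id, lift_id]
    exact (mul_le_mul_left hκ _).trans (mul_eq_self hκ0).le
  have hZκ : #((Rᶜ : Set S) ⊕ S × κ) ≤ #κ := by
    rw [mk_sum, lift_id, lift_id]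
    exact (add_le_add ((mk_set_le _).trans hκ) hYκ).trans (add_eq_self hκ0).le
  have hR : ∀ (p : unitIntertwiners x) (s : S), s ∉ R → (p.1.1 : S) * s ∉ R := by
    rintro p s hs ⟨s', hs'⟩
    refine hs ⟨(p⁻¹).1.2 * s', ?_⟩
    have h : ((p⁻¹).1.1 : S) * x = x * (p⁻¹).1.2 := (p⁻¹).2
    change x * _ = _
    rw [← mul_assoc, ← h, mul_assoc]
    change _ * (x * s') = _
    rw [show x * s' = _ from hs']
    simp
  have fst_eq_one : ∀ p : unitIntertwiners x, p.1.1 = 1 → p = 1 := by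
    rintro ⟨⟨k, l⟩, h⟩ (rfl : k = 1)
    have h : ((1 : Sˣ) : S) * x = x * l := h
    have : (l : S) = 1 := hl x _ _ (by rw [← h]; simp)
    ext <;> simp [this]
  have snd_eq_one : ∀ p : unitIntertwiners x, p.1.2 = 1 → p = 1 := by
    rintro ⟨⟨k, l⟩, h⟩ (rfl : l = 1)
    have h : (k : S) * x = x * ((1 : Sˣ) : S) := h
    have : (k : S) = 1 := hr _ _ x (by rw [h]; simp)
    ext <;> simp [this]
  have unit_eq_one : ∀ (u : Sˣ) (s : S), (u : S) * s = s → u = 1 := fun u s h =>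
    Units.ext (hr _ _ s (by simpa using h))
  let actY : MulAction (unitIntertwiners x) (S × κ) :=
    { smul p y := (p.1.2 * y.1, y.2)
      one_smul y := Prod.ext (one_mul y.1) rfl
      mul_smul p q y := Prod.ext (mul_assoc (p.1.2 : S) q.1.2 y.1) rfl }
  let actZ : MulAction (unitIntertwiners x) ((Rᶜ : Set S) ⊕ S × κ) :=
    { smul p := Sum.map (fun s => ⟨p.1.1 * s.1, hR p s.1 s.2⟩) (fun y => (p.1.1 * y.1, y.2))
      one_smul := by
        rintro (s | y)
        · exact congrArg Sum.inl (Subtype.ext (one_mul s.1))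
        · exact congrArg Sum.inr (Prod.ext (one_mul y.1) rfl)
      mul_smul := by
        rintro p q (s | y)
        · exact congrArg Sum.inl (Subtype.ext (mul_assoc (p.1.1 : S) q.1.1 s.1))
        · exact congrArg Sum.inr (Prod.ext (mul_assoc (p.1.1 : S) q.1.1 y.1) rfl) }
  obtain ⟨e, he⟩ := exists_equivariant_equiv (P := unitIntertwiners x) (Y := S × κ)
    (Z := (Rᶜ : Set S) ⊕ S × κ) (κ := κ)
    (fun p y h => snd_eq_one p (unit_eq_one _ y.1 (congrArg Prod.fst h)))
    (by
      rintro p (s | y) h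
      · exact fst_eq_one p (unit_eq_one _ s.1 (congrArg Subtype.val (Sum.inl_injective h)))
      · exact fst_eq_one p (unit_eq_one _ y.1 (congrArg Prod.fst (Sum.inr_injective h))))
    hYκ hZκ (fun a => (1, a)) (fun a => Sum.inr (1, a))
    (fun p a b h => congrArg Prod.snd h)
    (fun p a b h => congrArg Prod.snd (Sum.inr_injective h))
  let m : S ≃ R := Equiv.ofInjective (x * ·) fun b c h => hl x b c h
  let t : Equiv.Perm (S ⊕ S × κ) := (m.sumCongr e).trans
    ((Equiv.sumAssoc _ _ _).symm.trans
      ((Equiv.Set.sumCompl R).sumCongr (Equiv.refl (S × κ))))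
  have t_inl : ∀ s, t (Sum.inl s) = Sum.inl (x * s) := fun s => rfl
  have t_inr : ∀ y, t (Sum.inr y) = Sum.map Subtype.val id (e y) := by
    intro y
    simp only [t, Equiv.trans_apply, Equiv.sumCongr_apply, Sum.map_inr]
    cases e y <;> simp
  refine ⟨t, t_inl, fun k l h => ?_⟩
  let p : unitIntertwiners x := ⟨(k, l), h⟩
  ext1 (s | y)
  · simp only [Equiv.Perm.mul_apply, t_inl, unitsPermSum_inl, ← mul_assoc, h]
  · simp only [Equiv.Perm.mul_apply, t_inr, unitsPermSum_inr]
    rw [show ((l : S) * y.1, y.2) = p • y from rfl, he]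
    cases e y <;> rfl

/-- A family of elements indexed by `S` that intertwines the units as left multiplications do
can be chosen compatibly with multiplication by units on both sides. -/
lemma exists_units_biequivariant {M : Type*} [Group M] (φ : Sˣ →* M) (Q : S → M → Prop)
    (hQ : ∀ (u v : Sˣ) a m, Q a m → Q (u * a * v) (φ u * m * φ v))
    (h : ∀ x, ∃ t, Q x t ∧ ∀ k l : Sˣ, (k : S) * x = x * l → φ k * t = t * φ l) :
    ∃ F : S → M, (∀ a, Q a (F a)) ∧ (∀ (u : Sˣ) a, F (u * a) = φ u * F a) ∧
      ∀ (u : Sˣ) a, F (a * u) = F a * φ u := by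
  choose t hQt ht using h
  let r : Setoid S :=
    { r a b := ∃ u v : Sˣ, a = u * b * v
      iseqv :=
        { refl a := ⟨1, 1, by simp⟩
          symm := by
            rintro a b ⟨u, v, rfl⟩
            exact ⟨u⁻¹, v⁻¹, by simp [mul_assoc]⟩
          trans := by
            rintro a b c ⟨u, v, rfl⟩ ⟨u', v', rfl⟩
            exact ⟨u * u', v' * v, by simp [mul_assoc]⟩ } }
  let rep : S → S := fun a => (Quotient.mk r a).out
  have rep_spec : ∀ a, ∃ u v : Sˣ, a = u * rep a * v := fun a =>
    r.symm (Quotient.mk_out a)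
  have rep_eq : ∀ (u v : Sˣ) a, rep (u * a * v) = rep a := fun u v a =>
    congrArg Quotient.out (Quotient.sound (s := r) ⟨u, v, rfl⟩)
  choose g k hgk using rep_spec
  let F : S → M := fun a => φ (g a) * t (rep a) * φ (k a)
  have F_eq : ∀ a (u v : Sˣ), a = u * rep a * v → F a = φ u * t (rep a) * φ v := by
    intro a u v huv
    have h1 : (u : S) * rep a * v = g a * rep a * k a := huv.symm.trans (hgk a)
    have h2 : ((u⁻¹ * g a : Sˣ) : S) * rep a = rep a * (v * (k a)⁻¹ : Sˣ) := by
      rw [Units.val_mul, Units.val_mul, mul_assoc, Units.inv_mul_eq_iff_eq_mul, ← mul_assoc,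
        ← mul_assoc, h1, Units.mul_inv_cancel_right]
    have h3 := ht _ _ _ h2
    simp only [map_mul, map_inv] at h3
    calc φ (g a) * t (rep a) * φ (k a)
        = φ u * ((φ u)⁻¹ * φ (g a) * t (rep a)) * φ (k a) := by group
      _ = φ u * t (rep a) * φ v := by rw [h3]; group
  refine ⟨F, fun a => ?_, fun u a => ?_, fun u a => ?_⟩
  · have := hQ (g a) (k a) _ _ (hQt (rep a))
    rwa [← hgk] at this
  · have hrep : rep (u * a) = rep a := by simpa using rep_eq u 1 a
    rw [F_eq (u * a) (u * g a) (k a)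
      (by rw [hrep, Units.val_mul, mul_assoc, mul_assoc, ← mul_assoc _ (rep a), ← hgk a]), hrep]
    simp only [F, map_mul, mul_assoc]
  · have hrep : rep (a * u) = rep a := by simpa using rep_eq 1 u a
    rw [F_eq (a * u) (g a) (k a * u)
      (by rw [hrep, Units.val_mul, ← mul_assoc, ← hgk a]), hrep]
    simp only [F, map_mul, mul_assoc]

/-- In a monoid with a length function every non-unit has an irreducible left factor. -/
lemma IsLengthFunction.exists_irreducible_mul {l : S → ℕ} (hl : IsLengthFunction l) (s : S)
    (hs : ¬IsUnit s) : ∃ a b : S, Irreducible a ∧ s = a * b := by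
  induction h : l s using Nat.strong_induction_on generalizing s with
  | _ n ih =>
    by_cases hirr : Irreducible s
    · exact ⟨s, 1, hirr, (mul_one s).symm⟩
    · rw [irreducible_iff] at hirr
      push Not at hirr
      obtain ⟨c, d, rfl, hc, hd⟩ := hirr hs
      have hd0 : l d ≠ 0 := fun h0 => hd ((hl.2 d).mp h0)
      obtain ⟨a, b, ha, rfl⟩ := ih (l c) (by rw [← h, hl.1]; omega) c hc rfl
      exact ⟨a, b * d, ha, mul_assoc a b d⟩

/-- A homomorphism on the units of an equidivisible monoid with a length function extends along
any compatible family of values on the irreducible elements. -/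
lemma Equidivisible.exists_monoidHom (hE : Equidivisible S)
    {l : S → ℕ} (hlen : IsLengthFunction l) {M : Type*} [Monoid M] (φ : Sˣ →* M) (F : S → M)
    (hF_left : ∀ (u : Sˣ) a, F (u * a) = φ u * F a)
    (hF_right : ∀ (u : Sˣ) a, F (a * u) = F a * φ u) :
    ∃ f : S →* M, (∀ u : Sˣ, f u = φ u) ∧ ∀ a, Irreducible a → f a = F a := by
  classical
  choose! a b ha hab using hlen.exists_irreducible_mul
  have length_lt : ∀ c d : S, Irreducible c → l d < l (c * d) := by
    intro c d hc
    have : l c ≠ 0 := fun h0 => hc.not_isUnit ((hlen.2 c).mp h0)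
    rw [hlen.1]
    omega
  have hb : ∀ s, ¬IsUnit s → l (b s) < l s := fun s hs => by
    conv_rhs => rw [hab s hs]
    exact length_lt _ _ (ha s hs)
  obtain ⟨f, hf⟩ : ∃ f : S → M, ∀ s, f s =
      if h : IsUnit s then φ h.unit else F (a s) * f (b s) := by
    refine ⟨(measure l).wf.fix fun s rec =>
      if h : IsUnit s then φ h.unit else F (a s) * rec (b s) (hb s h), fun s => ?_⟩
    rw [WellFounded.fix_eq]
  have f_unit : ∀ u : Sˣ, f u = φ u := fun u => by
    rw [hf, dif_pos u.isUnit]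
    exact congrArg φ (Units.ext rfl)
  have f_mul_of_lt : ∀ n, (∀ (u : Sˣ) s, l s < n → f (u * s) = φ u * f s) →
      ∀ c d : S, Irreducible c → l (c * d) ≤ n → f (c * d) = F c * f d := by
    intro n hn c d hc hcd
    have hnu : ¬IsUnit (c * d) := fun h => by
      have h0 := (hlen.2 _).mpr h
      have := length_lt c d hc
      omega
    have hlt := hb _ hnu
    rw [hf, dif_neg hnu]
    have ha' := ha _ hnu
    have heq := hab _ hnu
    generalize a (c * d) = a' at *
    generalize b (c * d) = b' at *
    rcases hE _ _ _ _ heq with ⟨v, rfl, rfl⟩ | ⟨v, rfl, rfl⟩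
    · obtain ⟨v, rfl⟩ := (hc.isUnit_or_isUnit rfl).resolve_left ha'.not_isUnit
      have hd : l d = l (v * d) := by rw [hlen.1, (hlen.2 _).mpr v.isUnit, zero_add]
      rw [hn v d (by omega), hF_right, mul_assoc]
    · obtain ⟨v, rfl⟩ := (ha'.isUnit_or_isUnit rfl).resolve_left hc.not_isUnit
      rw [hn v b' (by omega), hF_right, mul_assoc]
  have f_units_mul : ∀ n, ∀ (u : Sˣ) s, l s < n → f (u * s) = φ u * f s := by
    intro n
    induction n with
    | zero => exact fun u s h => absurd h (Nat.not_lt_zero _)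
    | succ n ih =>
      intro u s hs
      by_cases hu : IsUnit s
      · obtain ⟨v, rfl⟩ := hu
        rw [← Units.val_mul, f_unit, f_unit, map_mul]
      · have hirr : Irreducible ((u : S) * a s) := (irreducible_units_mul u).mpr (ha s hu)
        have hlen' : l (u * a s * b s) = l s := by
          rw [mul_assoc, ← hab s hu, hlen.1, (hlen.2 _).mpr u.isUnit, zero_add]
        have h1 := f_mul_of_lt n ih _ (b s) hirr (by omega)
        rw [mul_assoc, ← hab s hu] at h1
        rw [h1, hF_left, hf s, dif_neg hu, mul_assoc]
  have f_irreducible_mul : ∀ c d : S, Irreducible c → f (c * d) = F c * f d := fun c d hc =>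
    f_mul_of_lt _ (f_units_mul _) c d hc le_rfl
  have f_one : f 1 = 1 := by simpa using f_unit 1
  have f_mul : ∀ s s', f (s * s') = f s * f s' := by
    intro s s'
    induction h : l s using Nat.strong_induction_on generalizing s with
    | _ n ih =>
      by_cases hu : IsUnit s
      · obtain ⟨u, rfl⟩ := hu
        rw [f_units_mul _ u s' (Nat.lt_succ_self _), f_unit]
      · conv_lhs => rw [hab s hu]
        rw [mul_assoc, f_irreducible_mul _ _ (ha s hu), ih _ (h ▸ hb s hu) _ rfl, hf s,
          dif_neg hu, mul_assoc]
  refine ⟨⟨⟨f, f_one⟩, f_mul⟩, f_unit, fun c hc => ?_⟩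
  simpa [f_one] using f_irreducible_mul c 1 hc

end Units

/-- A left Rees monoid embeds in a group iff it is right cancellative. -/
theorem stmt19 {S : Type u} [Monoid S] (hS : IsLeftReesMonoid S) :
    (∃ (H : Type u) (_ : Group H) (f : S →* H), Function.Injective f) ↔
    ∀ a b c : S, a * c = b * c → a = b := by
  constructor
  · rintro ⟨H, _, f, hf⟩ a b c h
    exact hf (mul_right_cancel (b := f c) (by rw [← map_mul, h, map_mul]))
  · intro hr
    obtain ⟨hl, hE, ⟨l, hlen⟩, -⟩ := hS
    have hκ : Cardinal.mk S ≤ Cardinal.mk (ℕ × S) :=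
      Cardinal.mk_le_of_injective (f := fun s : S => ((0 : ℕ), s)) fun a b h => congrArg Prod.snd h
    obtain ⟨F, hF, hF_left, hF_right⟩ := exists_units_biequivariant (unitsPermSum S (ℕ × S))
      (fun x t => ∀ s, t (Sum.inl s) = Sum.inl (x * s))
      (fun u v a m h s => by simp [h, mul_assoc])
      (exists_perm_extending_mulLeft hκ hl hr)
    obtain ⟨f, hf_unit, hf_irr⟩ :=
      hE.exists_monoidHom hlen (unitsPermSum S (ℕ × S)) F hF_left hF_right
    have f_inl : ∀ s s', f s (Sum.inl s') = Sum.inl (s * s') := by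
      intro s s'
      induction h : l s using Nat.strong_induction_on generalizing s with
      | _ n ih =>
        by_cases hu : IsUnit s
        · obtain ⟨u, rfl⟩ := hu
          rw [hf_unit, unitsPermSum_inl]
        · obtain ⟨a, b, ha, rfl⟩ := hlen.exists_irreducible_mul s hu
          have ha0 : l a ≠ 0 := fun h0 => ha.not_isUnit ((hlen.2 a).mp h0)
          rw [map_mul, Equiv.Perm.mul_apply, ih (l b) (by rw [← h, hlen.1]; omega) b rfl,
            hf_irr a ha, hF, mul_assoc]
    refine ⟨Equiv.Perm (S ⊕ S × (ℕ × S)), inferInstance, f, fun a b hab => ?_⟩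
    have := congrArg (fun t => t (Sum.inl 1)) hab
    simpa [f_inl] using this
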